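/- Every 4-regular simple graph whose girth equals 5 (that is, it contains a cycle of length 5 and contains no cycle of length less than 5) admits a strong edge-coloring using at most 22 colors. -/

import Mathlib

/-- Two edges of `G` conflict in a strong edge-coloring: they share an endpoint,
or some endpoint of one is adjacent in `G` to some endpoint of the other. -/
def StrongConflict {V : Type*} (G : SimpleGraph V) (e f : Sym2 V) : Prop :=
  (∃ v, v ∈ e ∧ v ∈ f) ∨ (∃ u v, u ∈ e ∧ v ∈ f ∧ G.Adj u v)

/-- A strong edge-coloring of `G` with `k` colors: conflicting distinct edges
receive different colors. -/
def IsStrongEdgeColoring {V : Type*} (G : SimpleGraph V) {k : ℕ}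
    (C : G.edgeSet → Fin k) : Prop :=
  ∀ e f : G.edgeSet, e ≠ f → StrongConflict G (e : Sym2 V) (f : Sym2 V) → C e ≠ C f

/-- A greedy coloring in order of decreasing rank `ρ`, after the elements of the independent set `P`
have all received the color `0`. -/
theorem exists_greedy_coloring {E : Type*} [Fintype E] [DecidableEq E] {m : ℕ}
    (R : E → E → Prop) [DecidableRel R] (hR : ∀ e f, R e f → R f e)
    (P : Finset E) (hP : ∀ e ∈ P, ∀ f ∈ P, ¬ R e f) (ρ : E → ℕ)
    (hgood : ∀ a ∉ P, (Finset.univ.filter fun f => R a f ∧ (ρ a ≤ ρ f ∨ f ∈ P)).card ≤ m ∨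
      (Finset.univ.filter fun f => R a f ∧ f ∉ P).card + 1 ≤ m) :
    ∃ c : E → Fin (m + 1), ∀ e f, e ≠ f → R e f → c e ≠ c f := by
  suffices H : ∃ c : E → Fin (m + 1), (∀ e ∈ P, c e = 0) ∧
      ∀ e ∈ Finset.univ ∪ P, ∀ f ∈ Finset.univ ∪ P, e ≠ f → R e f → c e ≠ c f by
    obtain ⟨c, -, hc⟩ := H
    exact ⟨c, fun e f => hc e (by simp) f (by simp)⟩
  refine Finset.induction_on_min_value ρ Finset.univ
    (motive := fun s => ∃ c : E → Fin (m + 1), (∀ e ∈ P, c e = 0) ∧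
      ∀ e ∈ s ∪ P, ∀ f ∈ s ∪ P, e ≠ f → R e f → c e ≠ c f) ?_ ?_
  · refine ⟨fun _ => 0, fun _ _ => rfl, fun e he f hf _ h => ?_⟩
    simp only [Finset.empty_union] at he hf
    exact absurd h (hP e he f hf)
  · rintro a s has hmin ⟨c, hc0, hc⟩
    by_cases haP : a ∈ P
    · refine ⟨c, hc0, ?_⟩
      have : insert a s ∪ P = s ∪ P := by
        rw [Finset.insert_union, Finset.insert_eq_of_mem (Finset.mem_union_right _ haP)]
      rwa [this]
    let F := (Finset.univ.filter fun f => R a f ∧ f ∈ s ∪ P).image c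
    have hF : F.card ≤ m := by
      rcases hgood a haP with h | h
      · refine Finset.card_image_le.trans ((Finset.card_le_card ?_).trans h)
        intro f hf
        simp only [Finset.mem_filter, Finset.mem_univ, true_and, Finset.mem_union] at hf ⊢
        exact ⟨hf.1, hf.2.imp_left (hmin f)⟩
      · have hsub : F ⊆ insert 0 ((Finset.univ.filter fun f => R a f ∧ f ∉ P).image c) := by
          intro x hx
          obtain ⟨f, hf, rfl⟩ := Finset.mem_image.1 hx
          by_cases hfP : f ∈ P
          · simp [hc0 f hfP]
          · refine Finset.mem_insert_of_mem (Finset.mem_image_of_mem _ ?_)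
            simp_all
        exact (Finset.card_le_card hsub).trans ((Finset.card_insert_le _ _).trans
          ((Nat.add_le_add_right Finset.card_image_le 1).trans h))
    obtain ⟨x, hx⟩ : ∃ x, x ∉ F := by
      by_contra! h
      have := Finset.card_le_card (fun x _ => h x : (Finset.univ : Finset (Fin (m + 1))) ⊆ F)
      simp only [Finset.card_univ, Fintype.card_fin] at this
      omega
    have hxc : ∀ f ∈ s ∪ P, R a f → x ≠ c f := by
      rintro f hf h rfl
      exact hx (Finset.mem_image_of_mem _ (by simp [h, Finset.mem_union.1 hf]))
    refine ⟨Function.update c a x, fun e he => ?_, fun e he f hf hef h => ?_⟩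
    · rw [Function.update_of_ne (by rintro rfl; exact haP he), hc0 e he]
    · rw [Finset.insert_union, Finset.mem_insert] at he hf
      by_cases hea : e = a
      · subst hea
        rw [Function.update_self, Function.update_of_ne hef.symm]
        exact hxc f (hf.resolve_left hef.symm) h
      · rw [Function.update_of_ne hea]
        by_cases hfa : f = a
        · subst hfa
          rw [Function.update_self]
          exact (hxc e (he.resolve_left hea) (hR _ _ h)).symm
        · rw [Function.update_of_ne hfa]
          exact hc e (he.resolve_left hea) f (hf.resolve_left hfa) hef h

namespace SimpleGraph

variable {V : Type*} {G : SimpleGraph V}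

theorem not_adj_of_forall_isCycle_five_le
    (hshort : ∀ (v : V) (c : G.Walk v v), c.IsCycle → 5 ≤ c.length) {a b c : V}
    (hab : G.Adj a b) (hbc : G.Adj b c) : ¬ G.Adj a c := by
  intro hac
  have := hshort a (.cons hab (.cons hbc (.cons hac.symm .nil))) (by
    have := hab.ne; have := hbc.ne; have := hac.ne
    simp [Walk.cons_isCycle_iff, Walk.cons_isPath_iff]
    grind)
  simp at this

theorem eq_of_forall_isCycle_five_le
    (hshort : ∀ (v : V) (c : G.Walk v v), c.IsCycle → 5 ≤ c.length) {a b c d : V}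
    (hab : G.Adj a b) (hbc : G.Adj b c) (had : G.Adj a d) (hdc : G.Adj d c) (hac : a ≠ c) :
    b = d := by
  by_contra hbd
  have := hshort a (.cons hab (.cons hbc (.cons hdc.symm (.cons had.symm .nil)))) (by
    have := hab.ne; have := hbc.ne; have := had.ne; have := hdc.ne
    simp [Walk.cons_isCycle_iff, Walk.cons_isPath_iff]
    grind)
  simp at this

/-- Between three pairs of vertices that are joined by matchings, an independent transversal exists
in a triangle-free graph. -/
theorem exists_independent_transversal_of_pairs
    (h3 : ∀ {a b c : V}, G.Adj a b → G.Adj b c → ¬ G.Adj a c) {B C D : Finset V}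
    (hBC : ∀ b ∈ B, ∀ c ∈ C, ∀ c' ∈ C, G.Adj b c → G.Adj b c' → c = c')
    (hBD : ∀ b ∈ B, ∀ d ∈ D, ∀ d' ∈ D, G.Adj b d → G.Adj b d' → d = d')
    (hCB : ∀ c ∈ C, ∀ b ∈ B, ∀ b' ∈ B, G.Adj c b → G.Adj c b' → b = b')
    (hDB : ∀ d ∈ D, ∀ b ∈ B, ∀ b' ∈ B, G.Adj d b → G.Adj d b' → b = b')
    (hDC : ∀ d ∈ D, ∀ c ∈ C, ∀ c' ∈ C, G.Adj d c → G.Adj d c' → c = c')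
    (hB : 1 < B.card) (hC : 1 < C.card) (hD : 1 < D.card) :
    ∃ b ∈ B, ∃ c ∈ C, ∃ d ∈ D, ¬ G.Adj b c ∧ ¬ G.Adj b d ∧ ¬ G.Adj c d := by
  obtain ⟨b, hb, b', hb', hbb⟩ := Finset.one_lt_card.1 hB
  obtain ⟨c, hc, c', hc', hcc⟩ := Finset.one_lt_card.1 hC
  obtain ⟨d, hd, d', hd', hdd⟩ := Finset.one_lt_card.1 hD
  by_contra! H
  have e1 := H b hb c hc d hd
  have e2 := H b hb c hc d' hd'
  have e3 := H b hb c' hc' d hd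
  have e4 := H b hb c' hc' d' hd'
  have e5 := H b' hb' c hc d hd
  have e6 := H b' hb' c hc d' hd'
  have e7 := H b' hb' c' hc' d hd
  have e8 := H b' hb' c' hc' d' hd'
  clear H
  grind [G.adj_comm]

/-- Four triples of vertices that are joined by matchings in a triangle-free graph have an
independent transversal. -/
theorem exists_independent_transversal_of_triples [DecidableEq V] [DecidableRel G.Adj]
    (h3 : ∀ {a b c : V}, G.Adj a b → G.Adj b c → ¬ G.Adj a c) {ι : Type*} {W : ι → Finset V}
    {p q r s : ι} (hpq : p ≠ q) (hpr : p ≠ r) (hps : p ≠ s) (hqr : q ≠ r) (hqs : q ≠ s)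
    (hrs : r ≠ s) {I : Set ι} (hp : p ∈ I) (hq : q ∈ I) (hr : r ∈ I) (hs : s ∈ I)
    (hcard : ∀ i ∈ I, (W i).card = 3)
    (hW : ∀ i ∈ I, ∀ j ∈ I, i ≠ j → ∀ w ∈ W i, ∀ x ∈ W j, ∀ y ∈ W j,
      G.Adj w x → G.Adj w y → x = y) :
    ∃ a ∈ W p, ∃ b ∈ W q, ∃ c ∈ W r, ∃ d ∈ W s, ¬ G.Adj a b ∧ ¬ G.Adj a c ∧ ¬ G.Adj a d ∧
      ¬ G.Adj b c ∧ ¬ G.Adj b d ∧ ¬ G.Adj c d := by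
  obtain ⟨a, ha⟩ := Finset.card_pos.1 (by rw [hcard p hp]; norm_num)
  have key : ∀ j ∈ I, p ≠ j → 1 < ((W j).filter fun x => ¬ G.Adj a x).card := by
    intro j hj hpj
    have h1 : ((W j).filter fun x => G.Adj a x).card ≤ 1 := by
      refine Finset.card_le_one.2 fun x hx y hy => ?_
      rw [Finset.mem_filter] at hx hy
      exact hW p hp j hj hpj a ha x hx.1 y hy.1 hx.2 hy.2
    have h2 := Finset.card_filter_add_card_filter_not (s := W j) (fun x => G.Adj a x)
    rw [hcard j hj] at h2
    omega
  have hW' : ∀ i ∈ I, ∀ j ∈ I, i ≠ j → ∀ w ∈ (W i).filter fun x => ¬ G.Adj a x,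
      ∀ x ∈ (W j).filter fun x => ¬ G.Adj a x, ∀ y ∈ (W j).filter fun x => ¬ G.Adj a x,
      G.Adj w x → G.Adj w y → x = y := fun i hi j hj hij w hw x hx y hy =>
    hW i hi j hj hij w (Finset.mem_filter.1 hw).1 x (Finset.mem_filter.1 hx).1 y
      (Finset.mem_filter.1 hy).1
  obtain ⟨b, hb, c, hc, d, hd, hbc, hbd, hcd⟩ := exists_independent_transversal_of_pairs h3
    (hW' q hq r hr hqr) (hW' q hq s hs hqs) (hW' r hr q hq hqr.symm)
    (hW' s hs q hq hqs.symm) (hW' s hs r hr hrs.symm) (key q hq hpq) (key r hr hpr) (key s hs hps)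
  rw [Finset.mem_filter] at hb hc hd
  exact ⟨a, ha, b, hb.1, c, hc.1, d, hd.1, hb.2, hc.2, hd.2, hbc, hbd, hcd⟩

/-- In a 4-regular graph of girth at least 5, one can choose for each neighbor `x` of `r` a further
neighbor of `x` so that the chosen vertices are pairwise nonadjacent. -/
theorem exists_independent_second_neighbors [Fintype V] [DecidableRel G.Adj]
    (hreg : ∀ v, G.degree v = 4)
    (hshort : ∀ (v : V) (c : G.Walk v v), c.IsCycle → 5 ≤ c.length) (r : V) :
    ∃ t : V → V, (∀ x, G.Adj r x → G.Adj x (t x) ∧ t x ≠ r) ∧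
      ∀ x y, G.Adj r x → G.Adj r y → x ≠ y → ¬ G.Adj (t x) (t y) := by
  classical
  have h3 : ∀ {a b c : V}, G.Adj a b → G.Adj b c → ¬ G.Adj a c :=
    not_adj_of_forall_isCycle_five_le hshort
  obtain ⟨p, q, s, u, hpq, hps, hpu, hqs, hqu, hsu, hN⟩ :
      ∃ p q s u, p ≠ q ∧ p ≠ s ∧ p ≠ u ∧ q ≠ s ∧ q ≠ u ∧ s ≠ u ∧
        G.neighborFinset r = {p, q, s, u} := by
    obtain ⟨p, T, hpT, hT, hc⟩ := Finset.card_eq_succ.1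
      ((G.card_neighborFinset_eq_degree r).trans (hreg r))
    obtain ⟨q, s, u, hqs, hqu, hsu, rfl⟩ := Finset.card_eq_three.1 hc
    simp only [Finset.mem_insert, Finset.mem_singleton, not_or] at hpT
    exact ⟨p, q, s, u, hpT.1, hpT.2.1, hpT.2.2, hqs, hqu, hsu, hT.symm⟩
  have hadj : ∀ x, G.Adj r x ↔ x = p ∨ x = q ∨ x = s ∨ x = u := by
    intro x
    rw [← G.mem_neighborFinset, hN]
    simp
  obtain ⟨a, ha, b, hb, c, hc, d, hd, hab, hac, had, hbc, hbd, hcd⟩ :=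
    exists_independent_transversal_of_triples h3 (W := fun x => (G.neighborFinset x).erase r)
      hpq hps hpu hqs hqu hsu (I := {x | G.Adj r x}) (by simp [hadj]) (by simp [hadj])
      (by simp [hadj]) (by simp [hadj])
      (fun x hx => by
        rw [Finset.card_erase_of_mem (by simpa using SimpleGraph.Adj.symm hx),
          G.card_neighborFinset_eq_degree, hreg])
      (fun x hx y hy hxy w hw v hv v' hv' hwv hwv' => by
        simp only [Finset.mem_erase, mem_neighborFinset] at hw hv hv'
        refine eq_of_forall_isCycle_five_le hshort hwv hv.2.symm hwv' hv'.2.symm ?_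
        rintro rfl
        exact h3 hx hw.2 hy)
  simp only [Finset.mem_erase, mem_neighborFinset] at ha hb hc hd
  refine ⟨fun x => if x = p then a else if x = q then b else if x = s then c else d, ?_, ?_⟩
  · intro x hx
    rcases (hadj x).1 hx with rfl | rfl | rfl | rfl <;> grind
  · intro x y hx hy hxy
    have := G.adj_comm
    rcases (hadj x).1 hx with rfl | rfl | rfl | rfl <;>
      rcases (hadj y).1 hy with rfl | rfl | rfl | rfl <;> grind

/-- Some rank function on the vertices decreases towards a unique root in every component. -/
theorem exists_rank_with_unique_roots (G : SimpleGraph V) :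
    ∃ d : V → ℕ, (∀ u, d u ≠ 0 → ∃ w, G.Adj u w ∧ d w < d u) ∧
      ∀ u v, d u = 0 → d v = 0 → G.Reachable u v → u = v := by
  let root : V → V := fun u => (G.connectedComponentMk u).out
  have hroot : ∀ u, G.Reachable u (root u) := fun u =>
    (ConnectedComponent.exact (Quot.out_eq (G.connectedComponentMk u))).symm
  have hrootEq : ∀ u v, G.Reachable u v → root u = root v := fun u v h =>
    congrArg Quot.out (ConnectedComponent.sound h)
  refine ⟨fun u => G.dist u (root u), fun u hu => ?_, fun u v hu hv h => ?_⟩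
  · obtain ⟨p, hp⟩ := (hroot u).exists_walk_length_eq_dist
    obtain ⟨w, h, q, rfl⟩ := p.exists_eq_cons_of_ne fun h => hu ((hroot u).dist_eq_zero_iff.2 h)
    refine ⟨w, h, ?_⟩
    have := dist_le (q.copy rfl (hrootEq u w h.reachable))
    simp only [Walk.length_cons, Walk.length_copy] at hp this
    lia
  · rw [(hroot u).dist_eq_zero_iff.1 hu, (hroot v).dist_eq_zero_iff.1 hv, hrootEq u v h]

theorem card_conflict_le [Fintype V] [DecidableEq V] [DecidableRel G.Adj]
    (hreg : ∀ v, G.degree v = 4) {u v : V} (huv : G.Adj u v) {N : Finset (Sym2 V)}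
    (hN : ∀ f ∈ N, f ∈ G.edgeSet ∧ f ≠ s(u, v) ∧ StrongConflict G s(u, v) f) : N.card ≤ 24 := by
  have hinc : ∀ {x y}, G.Adj x y → ((G.incidenceFinset x).erase s(x, y)).card = 3 := by
    intro x y h
    rw [Finset.card_erase_of_mem (by simpa [mem_incidenceFinset] using h),
      card_incidenceFinset_eq_degree, hreg]
  let S : V → V → Finset (Sym2 V) := fun x y =>
    ((G.neighborFinset x).erase y).biUnion fun z => (G.incidenceFinset z).erase s(z, x)
  have hS : ∀ {x y}, G.Adj x y → (S x y).card ≤ 9 := by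
    intro x y h
    refine (Finset.card_biUnion_le_card_mul _ _ 3 fun z hz => ?_).trans_eq ?_
    · rw [hinc ((G.mem_neighborFinset _ _).1 (Finset.mem_of_mem_erase hz)).symm]
    · rw [Finset.card_erase_of_mem (by simpa using h), G.card_neighborFinset_eq_degree, hreg]
  have hsub : N ⊆ ((G.incidenceFinset u).erase s(u, v) ∪ (G.incidenceFinset v).erase s(v, u)) ∪
      (S u v ∪ S v u) := by
    intro f hf
    obtain ⟨hfG, hne, hconf⟩ := hN f hf
    by_cases hu : u ∈ f
    · simp [mem_incidenceFinset, incidenceSet, hu, hfG, hne]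
    by_cases hv : v ∈ f
    · simp [mem_incidenceFinset, incidenceSet, hv, hfG, hne, Sym2.eq_swap (a := v)]
    have hz : ∃ z ∈ f, G.Adj u z ∨ G.Adj v z := by
      rcases hconf with ⟨x, hx, hxf⟩ | ⟨x, z, hx, hzf, hxz⟩
      · rcases Sym2.mem_iff.1 hx with rfl | rfl <;> contradiction
      · rcases Sym2.mem_iff.1 hx with rfl | rfl
        exacts [⟨z, hzf, .inl hxz⟩, ⟨z, hzf, .inr hxz⟩]
    obtain ⟨z, hzf, hz⟩ := hz
    refine Finset.mem_union_right _ (Finset.mem_union.2 (hz.imp (fun h => ?_) (fun h => ?_))) <;>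
    · refine Finset.mem_biUnion.2 ⟨z, ?_, ?_⟩
      · simp only [Finset.mem_erase, mem_neighborFinset]
        exact ⟨by rintro rfl; contradiction, h⟩
      · simp only [Finset.mem_erase, mem_incidenceFinset, incidenceSet, Set.mem_ofPred_eq]
        exact ⟨by rintro rfl; simp at hu hv, hfG, hzf⟩
  have h1 := Finset.card_le_card hsub
  have h2 := Finset.card_union_le
    ((G.incidenceFinset u).erase s(u, v) ∪ (G.incidenceFinset v).erase s(v, u)) (S u v ∪ S v u)
  have h3 := Finset.card_union_le
    ((G.incidenceFinset u).erase s(u, v)) ((G.incidenceFinset v).erase s(v, u))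
  have h4 := Finset.card_union_le (S u v) (S v u)
  have h5 := hinc huv
  have h6 := hinc huv.symm
  have h7 := hS huv
  have h8 := hS huv.symm
  lia

end SimpleGraph

theorem StrongConflict.symm {V : Type*} {G : SimpleGraph V} {e f : Sym2 V}
    (h : StrongConflict G e f) : StrongConflict G f e := by
  rcases h with ⟨v, he, hf⟩ | ⟨u, v, hu, hv, huv⟩
  · exact .inl ⟨v, hf, he⟩
  · exact .inr ⟨v, u, hv, hu, huv.symm⟩

theorem StrongConflict.reachable {V : Type*} {G : SimpleGraph V} {a b c d : V}
    (h : StrongConflict G s(a, b) s(c, d)) (hab : G.Adj a b) (hcd : G.Adj c d) :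
    G.Reachable a c := by
  have h1 : ∀ x ∈ s(a, b), G.Reachable a x := by
    intro x hx
    rcases Sym2.mem_iff.1 hx with rfl | rfl
    exacts [.rfl, hab.reachable]
  have h2 : ∀ x ∈ s(c, d), G.Reachable x c := by
    intro x hx
    rcases Sym2.mem_iff.1 hx with rfl | rfl
    exacts [.rfl, hcd.symm.reachable]
  rcases h with ⟨v, he, hf⟩ | ⟨u, v, hu, hv, huv⟩
  · exact (h1 v he).trans (h2 v hf)
  · exact (h1 u hu).trans (huv.reachable.trans (h2 v hv))

/-- Every 4-regular simple graph with girth exactly 5 (a 5-cycle exists and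
there is no cycle of length less than 5) has a strong edge-coloring with at
most 22 colors. -/
theorem strong_edge_coloring_4regular_girth_5 {V : Type*} [Fintype V]
    (G : SimpleGraph V) [DecidableRel G.Adj]
    (hreg : ∀ v, G.degree v = 4)
    (h5 : ∃ (v : V) (c : G.Walk v v), c.IsCycle ∧ c.length = 5)
    (hshort : ∀ (v : V) (c : G.Walk v v), c.IsCycle → 5 ≤ c.length) :
    ∃ C : G.edgeSet → Fin 22, IsStrongEdgeColoring G C := by
  classical
  have h3 : ∀ {a b c : V}, G.Adj a b → G.Adj b c → ¬ G.Adj a c :=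
    SimpleGraph.not_adj_of_forall_isCycle_five_le hshort
  obtain ⟨d, hd, hroot⟩ := SimpleGraph.exists_rank_with_unique_roots G
  choose t ht hind using SimpleGraph.exists_independent_second_neighbors hreg hshort
  let R : Sym2 V → Sym2 V → Prop := fun e f =>
    e ∈ G.edgeSet ∧ f ∈ G.edgeSet ∧ f ≠ e ∧ StrongConflict G e f
  let P : Finset (Sym2 V) :=
    Finset.univ.filter fun e => ∃ r x, d r = 0 ∧ G.Adj r x ∧ e = s(x, t r x)
  let ρ : Sym2 V → ℕ := Sym2.lift ⟨fun a b => min (d a) (d b), fun a b => min_comm _ _⟩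
  have hρ : ∀ w e, w ∈ e → ρ e ≤ d w := by
    intro w e hw
    induction e with | _ a b
    rcases Sym2.mem_iff.1 hw with rfl | rfl
    exacts [min_le_left _ _, min_le_right _ _]
  have hP : ∀ e ∈ P, ∀ f ∈ P, ¬ R e f := by
    rintro e he f hf ⟨-, -, hne, hconf⟩
    obtain ⟨r, x, hr, hrx, rfl⟩ := (Finset.mem_filter.1 he).2
    obtain ⟨r', y, hr', hry, rfl⟩ := (Finset.mem_filter.1 hf).2
    obtain ⟨hx, hxr⟩ := ht r x hrx
    obtain ⟨hy, hyr⟩ := ht r' y hry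
    obtain rfl : r = r' := hroot r r' hr hr'
      (hrx.reachable.trans ((hconf.reachable hx hy).trans hry.symm.reachable))
    have hxy : x ≠ y := by rintro rfl; exact hne rfl
    rcases hconf with ⟨v, hv, hv'⟩ | ⟨u, v, hu, hv, huv⟩
    · rcases Sym2.mem_iff.1 hv with rfl | rfl <;> rcases Sym2.mem_iff.1 hv' with h | h
      · exact hxy h
      · exact h3 hry (h ▸ hy) hrx
      · exact h3 hrx (h ▸ hx) hry
      · exact hxy (SimpleGraph.eq_of_forall_isCycle_five_le hshort hrx hx hry (h ▸ hy) hxr.symm)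
    · rcases Sym2.mem_iff.1 hu with rfl | rfl <;> rcases Sym2.mem_iff.1 hv with rfl | rfl
      · exact h3 hrx huv hry
      · exact hxy (SimpleGraph.eq_of_forall_isCycle_five_le hshort hrx huv hry hy hyr.symm)
      · exact hxy (SimpleGraph.eq_of_forall_isCycle_five_le hshort hrx hx hry huv.symm hxr.symm)
      · exact hind r x y hrx hry hxy huv
  have hPG : ∀ e ∈ P, e ∈ G.edgeSet := by
    intro e he
    obtain ⟨r, x, -, hrx, rfl⟩ := (Finset.mem_filter.1 he).2
    exact (ht r x hrx).1
  obtain ⟨c, hc⟩ := exists_greedy_coloring (m := 21) R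
    (fun e f h => ⟨h.2.1, h.1, h.2.2.1.symm, h.2.2.2.symm⟩) P hP ρ (by
      intro a ha
      by_cases haG : a ∉ G.edgeSet
      · left
        simp [R, haG]
      rw [not_not] at haG
      obtain ⟨u, v, hle, rfl⟩ : ∃ u v, d u ≤ d v ∧ a = s(u, v) := by
        induction a with | _ u v
        rcases le_total (d u) (d v) with h | h
        exacts [⟨u, v, h, rfl⟩, ⟨v, u, h, Sym2.eq_swap⟩]
      have huv : G.Adj u v := haG
      have hN : (Finset.univ.filter fun f => R s(u, v) f).card ≤ 24 :=
        SimpleGraph.card_conflict_le hreg huv fun f hf => (Finset.mem_filter.1 hf).2.2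
      by_cases hu : d u = 0
      · right
        let T := (G.neighborFinset u).image fun x => s(x, t u x)
        have hTP : T ⊆ P := by
          intro f hf
          obtain ⟨x, hx, rfl⟩ := Finset.mem_image.1 hf
          exact Finset.mem_filter.2 ⟨Finset.mem_univ _, u, x, hu, by simpa using hx, rfl⟩
        have hT : T.card = 4 := by
          rw [Finset.card_image_of_injOn, G.card_neighborFinset_eq_degree, hreg]
          intro x hx y hy hxy
          simp only [Finset.mem_coe, SimpleGraph.mem_neighborFinset] at hx hy
          rcases Sym2.eq_iff.1 hxy with h | h
          · exact h.1
          · exact absurd hx (h3 hy (h.1 ▸ (ht u y hy).1))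
        have hTN : T ⊆ Finset.univ.filter fun f => R s(u, v) f := by
          intro f hf
          have hfP := hTP hf
          obtain ⟨x, hx, rfl⟩ := Finset.mem_image.1 hf
          refine Finset.mem_filter.2 ⟨Finset.mem_univ _, haG, hPG _ hfP, ?_, .inr
            ⟨u, x, by simp, by simp, by simpa using hx⟩⟩
          intro h
          exact ha (h ▸ hfP)
        have hsub : (Finset.univ.filter fun f => R s(u, v) f ∧ f ∉ P) ⊆
            (Finset.univ.filter fun f => R s(u, v) f) \ T := by
          intro f hf
          simp only [Finset.mem_filter, Finset.mem_univ, true_and, Finset.mem_sdiff] at hf ⊢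
          exact ⟨hf.1, fun h => hf.2 (hTP h)⟩
        have h1 := Finset.card_le_card hsub
        rw [Finset.card_sdiff_of_subset hTN] at h1
        lia
      · left
        obtain ⟨w, huw, hw⟩ := hd u hu
        let T := G.incidenceFinset w \ P
        have hmemT : ∀ f ∈ T, f ∈ G.edgeSet ∧ w ∈ f ∧ f ∉ P := by
          intro f hf
          have h := Finset.mem_sdiff.1 hf
          exact ⟨((G.mem_incidenceFinset _ _).1 h.1).1, ((G.mem_incidenceFinset _ _).1 h.1).2, h.2⟩
        have hT : 3 ≤ T.card := by
          have h1 : (G.incidenceFinset w ∩ P).card ≤ 1 := by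
            refine Finset.card_le_one.2 fun e he f hf => ?_
            by_contra hne
            rw [Finset.mem_inter, SimpleGraph.mem_incidenceFinset] at he hf
            exact hP e he.2 f hf.2 ⟨he.1.1, hf.1.1, Ne.symm hne, .inl ⟨w, he.1.2, hf.1.2⟩⟩
          have h2 := Finset.card_sdiff_add_card_inter (G.incidenceFinset w) P
          rw [SimpleGraph.card_incidenceFinset_eq_degree, hreg] at h2
          lia
        have hlt : ∀ f, w ∈ f → ρ f < ρ s(u, v) := fun f hf =>
          (hρ w f hf).trans_lt (lt_min hw (hw.trans_le hle))
        have hTN : T ⊆ Finset.univ.filter fun f => R s(u, v) f := by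
          intro f hf
          obtain ⟨hfG, hwf, -⟩ := hmemT f hf
          refine Finset.mem_filter.2 ⟨Finset.mem_univ _, haG, hfG, ?_, .inr
            ⟨u, w, by simp, hwf, huw⟩⟩
          rintro rfl
          exact (hlt _ hwf).false
        have hsub : (Finset.univ.filter fun f => R s(u, v) f ∧ (ρ s(u, v) ≤ ρ f ∨ f ∈ P)) ⊆
            (Finset.univ.filter fun f => R s(u, v) f) \ T := by
          intro f hf
          simp only [Finset.mem_filter, Finset.mem_univ, true_and, Finset.mem_sdiff] at hf ⊢
          refine ⟨hf.1, fun h => ?_⟩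
          obtain ⟨-, hwf, hfP⟩ := hmemT f h
          exact hf.2.elim (hlt f hwf).not_ge hfP
        have h1 := Finset.card_le_card hsub
        rw [Finset.card_sdiff_of_subset hTN] at h1
        lia)
  exact ⟨fun e => c e, fun e f hef hconf => hc e f (Subtype.coe_ne_coe.2 hef)
    ⟨e.2, f.2, Subtype.coe_ne_coe.2 hef.symm, hconf⟩⟩
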